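/- For every alternating bilinear form T on ℝ^n and all u, v ∈ ℝ^n, writing B = ∑_{1≤k<l≤n} T(e_k,e_l) ĉ(e_k) ĉ(e_l), one has ∫_{S^{n−1}} Tr( ∑_{i=1}^n ξ_i · ĉ(u) ĉ(v) B c(e_i) c(ξ) ) dσ(ξ) = T(u,v) · 2^n · vol(S^{n−1}). -/

import Mathlib

open MeasureTheory

noncomputable section

/-- Euclidean space `ℝ^n` with its standard inner product. -/
abbrev Eucl (n : ℕ) := EuclideanSpace ℝ (Fin n)

/-- The exterior algebra `Λℝ^n`. -/
abbrev ExtAlg (n : ℕ) := ExteriorAlgebra ℝ (Eucl n)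

/-- The standard orthonormal basis vector `e_i` of `ℝ^n`. -/
def e (n : ℕ) (i : Fin n) : Eucl n := EuclideanSpace.single i 1

/-- Left exterior multiplication `ε(x)` on `Λℝ^n`. -/
def eps {n : ℕ} (x : Eucl n) : Module.End ℝ (ExtAlg n) :=
  LinearMap.mulLeft ℝ (ExteriorAlgebra.ι ℝ x)

/-- Interior multiplication (contraction) `ι(x)` on `Λℝ^n`, determined by the inner product. -/
def iot {n : ℕ} (x : Eucl n) : Module.End ℝ (ExtAlg n) :=
  CliffordAlgebra.contractLeft (Q := (0 : QuadraticForm ℝ (Eucl n))) (innerSL ℝ x).toLinearMap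

/-- The Clifford action `c(x) = ε(x) − ι(x)`. -/
def c {n : ℕ} (x : Eucl n) : Module.End ℝ (ExtAlg n) := eps x - iot x

/-- The Clifford action `ĉ(x) = ε(x) + ι(x)`. -/
def hc {n : ℕ} (x : Eucl n) : Module.End ℝ (ExtAlg n) := eps x + iot x

/-- The trace of a linear endomorphism of `Λℝ^n`. -/
def Tr {n : ℕ} : Module.End ℝ (ExtAlg n) →ₗ[ℝ] ℝ := LinearMap.trace ℝ (ExtAlg n)

/-- The surface measure `σ` on the unit sphere `S^{n-1} ⊆ ℝ^n`. -/
def sphMeasure (n : ℕ) : Measure (Metric.sphere (0 : Eucl n) 1) :=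
  (volume : Measure (Eucl n)).toSphere

/-- The total surface measure `vol(S^{n-1})` of the unit sphere. -/
def volSph (n : ℕ) : ℝ := (sphMeasure n Set.univ).toReal

theorem iot_mul_eps {n : ℕ} (x y : Eucl n) :
    iot x * eps y = inner ℝ x y • (1 : Module.End ℝ (ExtAlg n)) - eps y * iot x :=
  LinearMap.ext fun a => CliffordAlgebra.contractLeft_ι_mul
    (Q := (0 : QuadraticForm ℝ (Eucl n))) (innerSL ℝ x).toLinearMap y a

theorem eps_mul_eps {n : ℕ} (x y : Eucl n) : eps x * eps y = -(eps y * eps x) := by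
  refine LinearMap.ext fun a => ?_
  have h : ExteriorAlgebra.ι ℝ x * ExteriorAlgebra.ι ℝ y
      = -(ExteriorAlgebra.ι ℝ y * ExteriorAlgebra.ι ℝ x) :=
    eq_neg_of_add_eq_zero_left (ExteriorAlgebra.ι_add_mul_swap x y)
  simp only [eps, Module.End.mul_apply, LinearMap.neg_apply, LinearMap.mulLeft_apply,
    ← mul_assoc, h, neg_mul]

theorem iot_mul_iot {n : ℕ} (x y : Eucl n) : iot x * iot y = -(iot y * iot x) :=
  LinearMap.ext fun a => CliffordAlgebra.contractLeft_comm _ _ a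

theorem hc_mul_hc_add_swap {n : ℕ} (x y : Eucl n) :
    hc x * hc y + hc y * hc x = (2 * inner ℝ x y) • (1 : Module.End ℝ (ExtAlg n)) := by
  simp only [hc, mul_add, add_mul, iot_mul_eps, eps_mul_eps x y, iot_mul_iot x y,
    real_inner_comm x y]
  module

theorem c_mul_self {n : ℕ} (x : Eucl n) :
    c x * c x = (-inner ℝ x x) • (1 : Module.End ℝ (ExtAlg n)) := by
  have h₁ : eps x * eps x = 0 := LinearMap.ext fun a => by
    simp [eps, ← mul_assoc]
  have h₂ : iot x * iot x = 0 :=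
    LinearMap.ext fun a => CliffordAlgebra.contractLeft_contractLeft _ a
  simp only [c, mul_sub, sub_mul, iot_mul_eps, h₁, h₂]
  module

theorem sum_smul_e {n : ℕ} (x : Eucl n) : ∑ i, x i • e n i = x := by
  simpa [e] using (EuclideanSpace.basisFun (Fin n) ℝ).sum_repr x

/-- `c` as a linear map. -/
def cLin (n : ℕ) : Eucl n →ₗ[ℝ] Module.End ℝ (ExtAlg n) :=
  (LinearMap.mul ℝ (ExtAlg n)) ∘ₗ (ExteriorAlgebra.ι ℝ) -
    (CliffordAlgebra.contractLeft (Q := (0 : QuadraticForm ℝ (Eucl n)))) ∘ₗ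
      (innerₗ (Eucl n))

theorem cLin_apply {n : ℕ} (x : Eucl n) : cLin n x = c x := rfl

theorem sum_smul_c {n : ℕ} (x : Eucl n) : ∑ i, x i • c (e n i) = c x := by
  simp only [← cLin_apply, ← map_smul, ← map_sum, sum_smul_e]

theorem Tr_one (n : ℕ) : Tr (1 : Module.End ℝ (ExtAlg n)) = 2 ^ n := by
  let b := (EuclideanSpace.basisFun (Fin n) ℝ).toBasis.ExteriorAlgebra
  have : Module.Finite ℝ (ExtAlg n) := .of_basis b
  rw [Tr, LinearMap.trace_one, Module.finrank_eq_card_basis b]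
  simp

theorem Tr_mul_comm {n : ℕ} (f g : Module.End ℝ (ExtAlg n)) : Tr (f * g) = Tr (g * f) :=
  LinearMap.trace_mul_comm ℝ f g

theorem Tr_hc_mul_hc {n : ℕ} (x y : Eucl n) : Tr (hc x * hc y) = inner ℝ x y * 2 ^ n := by
  have h := congrArg Tr (hc_mul_hc_add_swap x y)
  rw [map_add, Tr_mul_comm (hc y), map_smul, Tr_one, smul_eq_mul] at h
  linarith

theorem Tr_hc_four {n : ℕ} (x y z w : Eucl n) :
    Tr (hc x * hc y * (hc z * hc w)) =
      (inner ℝ x y * inner ℝ z w - inner ℝ x z * inner ℝ y w + inner ℝ x w * inner ℝ y z)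
        * 2 ^ n := by
  have swap (y : Eucl n) :
      hc x * hc y = (2 * inner ℝ x y) • (1 : Module.End ℝ (ExtAlg n)) - hc y * hc x :=
    eq_sub_of_add_eq (hc_mul_hc_add_swap x y)
  have h : hc x * hc y * (hc z * hc w) =
      (2 * inner ℝ x y) • (hc z * hc w) - (2 * inner ℝ x z) • (hc y * hc w)
        + (2 * inner ℝ x w) • (hc y * hc z) - hc y * hc z * hc w * hc x := by
    calc hc x * hc y * (hc z * hc w)
        = (2 * inner ℝ x y) • (hc z * hc w) - hc y * (hc x * hc z) * hc w := by
          rw [swap y, sub_mul, smul_mul_assoc, one_mul]; noncomm_ring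
      _ = (2 * inner ℝ x y) • (hc z * hc w) - (2 * inner ℝ x z) • (hc y * hc w)
            + hc y * hc z * (hc x * hc w) := by
          rw [swap z, mul_sub, sub_mul, mul_smul_comm, smul_mul_assoc, mul_one]; noncomm_ring
      _ = _ := by
          rw [swap w, mul_sub, mul_smul_comm, mul_one]; noncomm_ring
  have h' := congrArg Tr h
  rw [map_sub, map_add, map_sub, map_smul, map_smul, map_smul, Tr_hc_mul_hc, Tr_hc_mul_hc,
    Tr_hc_mul_hc, Tr_mul_comm _ (hc x)] at h'
  simp only [mul_assoc, smul_eq_mul] at h' ⊢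
  linarith

theorem alternating_eq_sum {n : ℕ} (T : Eucl n [⋀^Fin 2]→ₗ[ℝ] ℝ) (u v : Eucl n) :
    T ![u, v] = ∑ k, ∑ l, u k * v l * T ![e n k, e n l] := by
  have left (x y : Eucl n) : T ![x, y] = ∑ k, x k * T ![e n k, y] := by
    have h := map_sum (T.toMultilinearMap.toLinearMap ![0, y] 0) (fun k => x k • e n k) Finset.univ
    have update_left (z : Eucl n) : Function.update ![0, y] 0 z = ![z, y] :=
      funext fun i => by fin_cases i <;> rfl
    simpa [sum_smul_e, update_left] using h
  have right (x y : Eucl n) : T ![x, y] = ∑ l, y l * T ![x, e n l] := by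
    have h := map_sum (T.toMultilinearMap.toLinearMap ![x, 0] 1) (fun k => y k • e n k) Finset.univ
    have update_right (z : Eucl n) : Function.update ![x, 0] 1 z = ![x, z] :=
      funext fun i => by fin_cases i <;> rfl
    simpa [sum_smul_e, update_right] using h
  rw [left]
  refine Finset.sum_congr rfl fun k _ => ?_
  rw [right, Finset.mul_sum]
  exact Finset.sum_congr rfl fun l _ => by ring

theorem alternating_eq_sum_lt {n : ℕ} (T : Eucl n [⋀^Fin 2]→ₗ[ℝ] ℝ) (u v : Eucl n) :
    T ![u, v] = ∑ k, ∑ l,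
      if k < l then T ![e n k, e n l] * (u k * v l - u l * v k) else 0 := by
  have antisymm (x y : Eucl n) : T ![x, y] = -T ![y, x] := by
    have swap : ![y, x] ∘ Equiv.swap (0 : Fin 2) 1 = ![x, y] :=
      funext fun i => by fin_cases i <;> rfl
    rw [← swap, T.map_swap ![y, x] (by decide)]
  have split (k l : Fin n) : u k * v l * T ![e n k, e n l] =
      (if k < l then u k * v l * T ![e n k, e n l] else 0) +
        if l < k then u k * v l * T ![e n k, e n l] else 0 := by
    rcases lt_trichotomy k l with h | rfl | h
    · simp [h, h.not_gt]
    · have : T ![e n k, e n k] = 0 := T.map_eq_zero_of_eq _ (i := 0) (j := 1) rfl (by decide)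
      simp [this]
    · simp [h, h.not_gt]
  rw [alternating_eq_sum]
  rw [Finset.sum_congr rfl fun k _ => Finset.sum_congr rfl fun l _ => split k l]
  simp_rw [Finset.sum_add_distrib]
  rw [Finset.sum_comm (f := fun k l => if l < k then u k * v l * T ![e n k, e n l] else 0),
    ← Finset.sum_add_distrib]
  refine Finset.sum_congr rfl fun k _ => ?_
  rw [← Finset.sum_add_distrib]
  refine Finset.sum_congr rfl fun l _ => ?_
  split_ifs
  · rw [antisymm (e n l)]; ring
  · simp

theorem Tr_hc_mul_hc_mul_form {n : ℕ} (T : Eucl n [⋀^Fin 2]→ₗ[ℝ] ℝ) (u v : Eucl n) :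
    Tr (hc u * hc v * ∑ k : Fin n, ∑ l : Fin n,
        if k < l then T ![e n k, e n l] • (hc (e n k) * hc (e n l)) else 0)
      = -(T ![u, v] * 2 ^ n) := by
  rw [alternating_eq_sum_lt]
  simp only [Finset.mul_sum, Finset.sum_mul, map_sum, ← Finset.sum_neg_distrib]
  refine Finset.sum_congr rfl fun k _ => Finset.sum_congr rfl fun l _ => ?_
  split_ifs with h
  · rw [mul_smul_comm, map_smul, Tr_hc_four]
    simp [e, EuclideanSpace.inner_single_right, h.ne]
    ring
  · simp

theorem stmt_3 (n : ℕ) (hn : 0 < n) (T : Eucl n [⋀^Fin 2]→ₗ[ℝ] ℝ) (u v : Eucl n)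
    (B : Module.End ℝ (ExtAlg n))
    (hB : B = ∑ k : Fin n, ∑ l : Fin n,
        if k < l then T ![e n k, e n l] • (hc (e n k) * hc (e n l)) else 0) :
    (∫ ξ : Metric.sphere (0 : Eucl n) 1,
        Tr (∑ i : Fin n, (ξ : Eucl n) i •
          (hc u * hc v * B * c (e n i) * ∑ j : Fin n, (ξ : Eucl n) j • c (e n j)))
        ∂sphMeasure n)
      = T ![u, v] * 2 ^ n * volSph n := by
  have integrand (ξ : Metric.sphere (0 : Eucl n) 1) :
      Tr (∑ i : Fin n, (ξ : Eucl n) i •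
        (hc u * hc v * B * c (e n i) * ∑ j : Fin n, (ξ : Eucl n) j • c (e n j)))
      = T ![u, v] * 2 ^ n := by
    have factor : ∑ i : Fin n, (ξ : Eucl n) i •
        (hc u * hc v * B * c (e n i) * ∑ j : Fin n, (ξ : Eucl n) j • c (e n j))
        = hc u * hc v * B * ((∑ i : Fin n, (ξ : Eucl n) i • c (e n i)) * c (ξ : Eucl n)) := by
      rw [← mul_assoc, Finset.mul_sum, Finset.sum_mul]
      simp only [mul_smul_comm, smul_mul_assoc, sum_smul_c]
    rw [factor, sum_smul_c, c_mul_self, real_inner_self_eq_norm_sq, norm_eq_of_mem_sphere,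
      one_pow, mul_smul_comm, mul_one, map_smul, hB, Tr_hc_mul_hc_mul_form, smul_eq_mul, neg_mul_neg,
      one_mul]
  simp only [integrand, integral_const, smul_eq_mul, volSph, Measure.real]
  ring
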